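/- arXiv:2512.14400 — 4 statements merged into one kernel-verified Lean document; each statement's English description precedes it below -/
import Mathlib

section
/- (Lyapunov monotonicity, Theorem 2 / Lemma B.2.) Fix α ≥ 1, β > 0 and memory patterns ξ_1, …, ξ_M ∈ ℝ^d with matrix Ξ. For every x ∈ ℝ^d and every maximizer p ∈ Δ_M of q ↦ ⟨q, β Ξᵀ x⟩ − Ψ_α(q), setting x' = Ξ p one has H(x') ≤ H(x), where H(x) = −(1/β) g(β Ξᵀ x) + ½‖x‖₂². Consequently, along any sequence defined by x_{t+1} = T(x_t) the energy values H(x_t) are non-increasing in t. -/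
open Finset Real RealInnerProductSpace

noncomputable section

/-- The probability simplex `Δ_M ⊆ ℝ^M`. -/
def simplex (M : ℕ) : Set (Fin M → ℝ) :=
  {p | (∀ μ, 0 ≤ p μ) ∧ ∑ μ, p μ = 1}

/-- The negative Tsallis `α`-entropy `Ψ_α` (negative Shannon entropy for `α = 1`). -/
noncomputable def Psi (α : ℝ) (M : ℕ) (p : Fin M → ℝ) : ℝ :=
  if α = 1 then ∑ μ, p μ * Real.log (p μ)
  else (1 / (α * (α - 1))) * ∑ μ, (p μ ^ α - p μ)

/-- The convex conjugate of `Ψ_α` restricted to the simplex: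
`g(z) = sup_{p ∈ Δ_M} (⟨p, z⟩ − Ψ_α(p))`. -/
noncomputable def conjG (α : ℝ) (M : ℕ) (z : Fin M → ℝ) : ℝ :=
  sSup ((fun p => (∑ μ, p μ * z μ) - Psi α M p) '' simplex M)

open Classical in
/-- `α`-EntMax: a maximizer of `p ↦ ⟨p, z⟩ − Ψ_α(p)` over the simplex (chosen by choice;
it is the unique maximizer when `α ≥ 1`). -/
noncomputable def entMax (α : ℝ) (M : ℕ) (z : Fin M → ℝ) : Fin M → ℝ :=
  if h : ∃ p ∈ simplex M, ∀ q ∈ simplex M,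
      (∑ μ, q μ * z μ) - Psi α M q ≤ (∑ μ, p μ * z μ) - Psi α M p
  then h.choose else 0

/-- The generalized sparse Hopfield energy
`H(x) = −(1/β) g(β Ξᵀ x) + ½‖x‖₂²`. -/
noncomputable def hopEnergy (α β : ℝ) (d M : ℕ) (ξ : Fin M → EuclideanSpace ℝ (Fin d))
    (x : EuclideanSpace ℝ (Fin d)) : ℝ :=
  -(1 / β) * conjG α M (fun ν => β * ⟪ξ ν, x⟫) + (1 / 2) * ‖x‖ ^ 2

/-- The retrieval map `T(x) = Ξ · α-EntMax(β Ξᵀ x)`. -/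
noncomputable def retrieve (α β : ℝ) (d M : ℕ) (ξ : Fin M → EuclideanSpace ℝ (Fin d))
    (x : EuclideanSpace ℝ (Fin d)) : EuclideanSpace ℝ (Fin d) :=
  ∑ ν, entMax α M (fun κ => β * ⟪ξ κ, x⟫) ν • ξ ν

theorem aux_exists (α : ℝ) (hα : 1 ≤ α) (M : ℕ) (hM : 1 ≤ M) (z : Fin M → ℝ) :
    ∃ p ∈ simplex M, ∀ q ∈ simplex M,
      (∑ μ, q μ * z μ) - Psi α M q ≤ (∑ μ, p μ * z μ) - Psi α M p := by
  have hs : simplex M = stdSimplex ℝ (Fin M) := rfl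
  have hc : IsCompact (simplex M) := by
    rw [hs]; exact isCompact_stdSimplex ℝ (Fin M)
  have hne : (simplex M).Nonempty := by
    rw [hs]; exact ⟨_, single_mem_stdSimplex ℝ (⟨0, hM⟩ : Fin M)⟩
  have hpsi : Continuous (Psi α M) := by
    unfold Psi
    by_cases h : α = 1
    · simp only [h, if_true]
      exact continuous_finsetSum _ fun μ _ =>
        Real.continuous_mul_log.comp (continuous_apply μ)
    · simp only [h, if_false]
      refine continuous_const.mul (continuous_finsetSum _ fun μ _ => ?_)
      exact ((Real.continuous_rpow_const (by linarith)).comp (continuous_apply μ)).sub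
        (continuous_apply μ)
  have hcont : Continuous (fun p : Fin M → ℝ => (∑ μ, p μ * z μ) - Psi α M p) := by
    refine Continuous.sub ?_ hpsi
    fun_prop
  obtain ⟨p, hp, hmax⟩ := hc.exists_isMaxOn hne hcont.continuousOn
  exact ⟨p, hp, fun q hq => hmax hq⟩

theorem aux_eq (α : ℝ) (M : ℕ) (z p : Fin M → ℝ) (hp : p ∈ simplex M)
    (h : ∀ q ∈ simplex M,
      (∑ μ, q μ * z μ) - Psi α M q ≤ (∑ μ, p μ * z μ) - Psi α M p) :
    conjG α M z = (∑ μ, p μ * z μ) - Psi α M p := by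
  unfold conjG
  refine IsGreatest.csSup_eq ⟨⟨p, hp, rfl⟩, ?_⟩
  rintro _ ⟨q, hq, rfl⟩
  exact h q hq

theorem aux_step (α β : ℝ) (hα : 1 ≤ α) (hβ : 0 < β) (d M : ℕ) (hM : 1 ≤ M)
    (ξ : Fin M → EuclideanSpace ℝ (Fin d)) (x : EuclideanSpace ℝ (Fin d))
    (p : Fin M → ℝ) (hp : p ∈ simplex M)
    (h : ∀ q ∈ simplex M,
        (∑ μ, q μ * (β * ⟪ξ μ, x⟫)) - Psi α M q ≤
          (∑ μ, p μ * (β * ⟪ξ μ, x⟫)) - Psi α M p) :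
    hopEnergy α β d M ξ (∑ ν, p ν • ξ ν) ≤ hopEnergy α β d M ξ x := by
  have key : ∀ y : EuclideanSpace ℝ (Fin d),
      ∑ μ, p μ * (β * ⟪ξ μ, y⟫) = β * ⟪∑ ν, p ν • ξ ν, y⟫ := by
    intro y
    rw [sum_inner, Finset.mul_sum]
    refine Finset.sum_congr rfl fun μ _ => ?_
    rw [real_inner_smul_left]; ring
  have e1 := aux_eq α M (fun ν => β * ⟪ξ ν, x⟫) p hp h
  simp only [key x] at e1
  set x' := ∑ ν, p ν • ξ ν with hx'
  obtain ⟨r, hr, hrm⟩ := aux_exists α hα M hM (fun ν => β * ⟪ξ ν, x'⟫)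
  have e2 := aux_eq α M _ r hr hrm
  have e3 := hrm p hp
  rw [← e2] at e3
  simp only [key x'] at e3
  unfold hopEnergy
  rw [e1]
  have e4 : (1 / β) * (β * ⟪x', x'⟫ - Psi α M p) ≤
      (1 / β) * conjG α M (fun ν => β * ⟪ξ ν, x'⟫) :=
    mul_le_mul_of_nonneg_left e3 (by positivity)
  have e5 : ∀ y : EuclideanSpace ℝ (Fin d), (1 / β) * (β * ⟪x', y⟫ - Psi α M p) =
      ⟪x', y⟫ - (1 / β) * Psi α M p := by
    intro y; field_simp
  have e6 := e5 x
  rw [e5 x', real_inner_self_eq_norm_sq] at e4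
  have e7 := norm_sub_sq_real x' x
  have e8 := sq_nonneg ‖x' - x‖
  linarith

/-- Lyapunov monotonicity, Theorem 2 / Lemma B.2: one step of the
retrieval map does not increase the Hopfield energy, and along any trajectory
`x_{t+1} = T(x_t)` the energies are non-increasing. -/
theorem stmt8 (α β : ℝ) (hα : 1 ≤ α) (hβ : 0 < β) (d M : ℕ) (hM : 1 ≤ M)
    (ξ : Fin M → EuclideanSpace ℝ (Fin d)) :
    (∀ x : EuclideanSpace ℝ (Fin d), ∀ p ∈ simplex M,
      (∀ q ∈ simplex M,
        (∑ μ, q μ * (β * ⟪ξ μ, x⟫)) - Psi α M q ≤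
          (∑ μ, p μ * (β * ⟪ξ μ, x⟫)) - Psi α M p) →
      hopEnergy α β d M ξ (∑ ν, p ν • ξ ν) ≤ hopEnergy α β d M ξ x) ∧
    ∀ x₀ : EuclideanSpace ℝ (Fin d), ∀ t : ℕ,
      hopEnergy α β d M ξ ((retrieve α β d M ξ)^[t + 1] x₀) ≤
        hopEnergy α β d M ξ ((retrieve α β d M ξ)^[t] x₀) := by
  have step := aux_step α β hα hβ d M hM ξ
  refine ⟨step, fun x₀ t => ?_⟩
  rw [Function.iterate_succ_apply']
  set x := (retrieve α β d M ξ)^[t] x₀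
  have hex := aux_exists α hα M hM (fun κ => β * ⟪ξ κ, x⟫)
  have he : entMax α M (fun κ => β * ⟪ξ κ, x⟫) = hex.choose := by
    unfold entMax
    rw [dif_pos hex]
  have hs := hex.choose_spec
  rw [← he] at hs
  exact step x _ hs.1 hs.2
end
end

section
/- Fix α ≥ 1, β > 0 and memory patterns ξ_1, …, ξ_M ∈ ℝ^d with matrix Ξ, and let m = max_μ ‖ξ_μ‖₂. Then the Hopfield energy satisfies H(x) ≥ ½‖x‖₂² − m‖x‖₂ + (1/β) min_{p ∈ Δ_M} Ψ_α(p) for all x ∈ ℝ^d; in particular H is bounded below on ℝ^d, and therefore for any initial point x₀ the energy sequence H(x_t), where x_{t+1} = T(x_t), is non-increasing and bounded below, hence convergent. -/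
open Finset Real RealInnerProductSpace

noncomputable section

lemma sum_inner_aux (β : ℝ) (d M : ℕ) (ξ : Fin M → EuclideanSpace ℝ (Fin d))
    (p : Fin M → ℝ) (x : EuclideanSpace ℝ (Fin d)) :
    ∑ ν, p ν * (β * ⟪ξ ν, x⟫) = β * ⟪∑ ν, p ν • ξ ν, x⟫ := by
  rw [sum_inner, Finset.mul_sum]
  refine Finset.sum_congr rfl fun ν _ => ?_
  rw [real_inner_smul_left]; ring

lemma simplex_compact (M : ℕ) : IsCompact (simplex M) := isCompact_stdSimplex ℝ (Fin M)

lemma simplex_nonempty (M : ℕ) (hM : 1 ≤ M) : (simplex M).Nonempty :=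
  ⟨Pi.single ⟨0, hM⟩ 1, single_mem_stdSimplex ℝ (⟨0, hM⟩ : Fin M)⟩

lemma Psi_continuous (α : ℝ) (hα : 1 ≤ α) (M : ℕ) : Continuous (Psi α M) := by
  unfold Psi
  split_ifs
  · exact continuous_finsetSum _ fun μ _ => Real.continuous_mul_log.comp (continuous_apply μ)
  · refine continuous_const.mul (continuous_finsetSum _ fun μ _ => ?_)
    exact ((continuous_apply μ).rpow_const fun _ => Or.inr (by linarith)).sub (continuous_apply μ)

lemma obj_continuous (α : ℝ) (hα : 1 ≤ α) (M : ℕ) (z : Fin M → ℝ) :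
    Continuous (fun p : Fin M → ℝ => (∑ μ, p μ * z μ) - Psi α M p) :=
  (continuous_finsetSum _ fun μ _ => (continuous_apply μ).mul continuous_const).sub
    (Psi_continuous α hα M)

lemma le_conjG (α : ℝ) (hα : 1 ≤ α) (M : ℕ) (z p : Fin M → ℝ) (hp : p ∈ simplex M) :
    (∑ μ, p μ * z μ) - Psi α M p ≤ conjG α M z :=
  le_csSup ((simplex_compact M).bddAbove_image (obj_continuous α hα M z).continuousOn)
    ⟨p, hp, rfl⟩

lemma entMax_spec (α : ℝ) (hα : 1 ≤ α) (M : ℕ) (hM : 1 ≤ M) (z : Fin M → ℝ) :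
    entMax α M z ∈ simplex M ∧
      conjG α M z = (∑ μ, entMax α M z μ * z μ) - Psi α M (entMax α M z) := by
  have h : ∃ p ∈ simplex M, ∀ q ∈ simplex M,
      (∑ μ, q μ * z μ) - Psi α M q ≤ (∑ μ, p μ * z μ) - Psi α M p := by
    obtain ⟨p, hp, h⟩ := (simplex_compact M).exists_isMaxOn (simplex_nonempty M hM)
      (obj_continuous α hα M z).continuousOn
    exact ⟨p, hp, fun q hq => h hq⟩
  have he : entMax α M z = h.choose := by unfold entMax; rw [dif_pos h]
  rw [he]
  obtain ⟨h1, h2⟩ := h.choose_spec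
  refine ⟨h1, le_antisymm ?_ (le_conjG α hα M z _ h1)⟩
  refine csSup_le ((simplex_nonempty M hM).image _) ?_
  rintro _ ⟨q, hq, rfl⟩
  exact h2 q hq

lemma energy_eq (α β : ℝ) (hα : 1 ≤ α) (hβ : 0 < β) (d M : ℕ) (hM : 1 ≤ M)
    (ξ : Fin M → EuclideanSpace ℝ (Fin d)) (x : EuclideanSpace ℝ (Fin d)) :
    hopEnergy α β d M ξ x = -⟪retrieve α β d M ξ x, x⟫ +
      (1 / β) * Psi α M (entMax α M (fun κ => β * ⟪ξ κ, x⟫)) + (1 / 2) * ‖x‖ ^ 2 := by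
  unfold hopEnergy retrieve
  rw [(entMax_spec α hα M hM _).2, sum_inner_aux]
  field_simp
  ring

lemma energy_le (α β : ℝ) (hα : 1 ≤ α) (hβ : 0 < β) (d M : ℕ)
    (ξ : Fin M → EuclideanSpace ℝ (Fin d)) (y : EuclideanSpace ℝ (Fin d))
    (p : Fin M → ℝ) (hp : p ∈ simplex M) :
    hopEnergy α β d M ξ y ≤ -⟪∑ ν, p ν • ξ ν, y⟫ +
      (1 / β) * Psi α M p + (1 / 2) * ‖y‖ ^ 2 := by
  unfold hopEnergy
  have h := le_conjG α hα M (fun ν => β * ⟪ξ ν, y⟫) p hp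
  rw [sum_inner_aux] at h
  have h2 := mul_le_mul_of_nonneg_left h (one_div_pos.mpr hβ).le
  have h3 : (1 / β) * (β * ⟪∑ ν, p ν • ξ ν, y⟫ - Psi α M p)
      = ⟪∑ ν, p ν • ξ ν, y⟫ - (1 / β) * Psi α M p := by
    field_simp
  linarith

lemma energy_step (α β : ℝ) (hα : 1 ≤ α) (hβ : 0 < β) (d M : ℕ) (hM : 1 ≤ M)
    (ξ : Fin M → EuclideanSpace ℝ (Fin d)) (x : EuclideanSpace ℝ (Fin d)) :
    hopEnergy α β d M ξ (retrieve α β d M ξ x) ≤ hopEnergy α β d M ξ x := by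
  have h1 := energy_le α β hα hβ d M ξ (retrieve α β d M ξ x) _
    (entMax_spec α hα M hM (fun κ => β * ⟪ξ κ, x⟫)).1
  rw [energy_eq α β hα hβ d M hM ξ x]
  change _ ≤ -⟪retrieve α β d M ξ x, retrieve α β d M ξ x⟫ + _ + _ at h1
  rw [real_inner_self_eq_norm_sq] at h1
  have h2 := norm_sub_sq_real (retrieve α β d M ξ x) x
  nlinarith [sq_nonneg ‖retrieve α β d M ξ x - x‖]

/-- with `m = max_μ ‖ξ_μ‖₂`, the Hopfield energy satisfies
`H(x) ≥ ½‖x‖² − m‖x‖ + (1/β) min_{p ∈ Δ_M} Ψ_α(p)`; in particular `H` is bounded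
below, and hence along any trajectory `x_{t+1} = T(x_t)` the energy sequence is
non-increasing, bounded below, and convergent. -/
theorem stmt9 (α β : ℝ) (hα : 1 ≤ α) (hβ : 0 < β) (d M : ℕ) (hM : 1 ≤ M)
    (ξ : Fin M → EuclideanSpace ℝ (Fin d)) (m : ℝ)
    (hm : m = Finset.univ.sup' (Finset.univ_nonempty_iff.mpr ⟨⟨0, hM⟩⟩)
      (fun ν => ‖ξ ν‖)) :
    (∀ x : EuclideanSpace ℝ (Fin d),
      (1 / 2) * ‖x‖ ^ 2 - m * ‖x‖ + (1 / β) * sInf (Psi α M '' simplex M) ≤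
        hopEnergy α β d M ξ x) ∧
    BddBelow (Set.range (hopEnergy α β d M ξ)) ∧
    ∀ x₀ : EuclideanSpace ℝ (Fin d),
      (∀ t : ℕ,
        hopEnergy α β d M ξ ((retrieve α β d M ξ)^[t + 1] x₀) ≤
          hopEnergy α β d M ξ ((retrieve α β d M ξ)^[t] x₀)) ∧
      ∃ L : ℝ, Filter.Tendsto (fun t => hopEnergy α β d M ξ ((retrieve α β d M ξ)^[t] x₀))
        Filter.atTop (nhds L) := by
  have hx : ∀ x : EuclideanSpace ℝ (Fin d),
      (1 / 2) * ‖x‖ ^ 2 - m * ‖x‖ + (1 / β) * sInf (Psi α M '' simplex M) ≤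
        hopEnergy α β d M ξ x := by
    intro x
    rw [energy_eq α β hα hβ d M hM ξ x]
    have hs := (entMax_spec α hα M hM (fun κ => β * ⟪ξ κ, x⟫)).1
    have h1 : sInf (Psi α M '' simplex M) ≤ Psi α M (entMax α M (fun κ => β * ⟪ξ κ, x⟫)) :=
      csInf_le ((simplex_compact M).bddBelow_image (Psi_continuous α hα M).continuousOn)
        ⟨_, hs, rfl⟩
    have h2 := mul_le_mul_of_nonneg_left h1 (one_div_pos.mpr hβ).le
    have h3 : ‖retrieve α β d M ξ x‖ ≤ m := by
      unfold retrieve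
      refine (norm_sum_le _ _).trans ?_
      calc _ ≤ ∑ ν, entMax α M (fun κ => β * ⟪ξ κ, x⟫) ν * m := by
            refine Finset.sum_le_sum fun ν _ => ?_
            rw [norm_smul, Real.norm_of_nonneg (hs.1 ν)]
            refine mul_le_mul_of_nonneg_left ?_ (hs.1 ν)
            rw [hm]
            exact Finset.le_sup' (fun ν => ‖ξ ν‖) (Finset.mem_univ ν)
        _ = m := by rw [← Finset.sum_mul, hs.2, one_mul]
    have h4 := real_inner_le_norm (retrieve α β d M ξ x) x
    have h5 := mul_le_mul_of_nonneg_right h3 (norm_nonneg x)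
    linarith
  have hb : BddBelow (Set.range (hopEnergy α β d M ξ)) := by
    refine ⟨-(1 / 2) * m ^ 2 + (1 / β) * sInf (Psi α M '' simplex M), ?_⟩
    rintro _ ⟨x, rfl⟩
    have := hx x
    nlinarith [sq_nonneg (‖x‖ - m)]
  refine ⟨hx, hb, fun x₀ => ?_⟩
  have hstep : ∀ t : ℕ,
        hopEnergy α β d M ξ ((retrieve α β d M ξ)^[t + 1] x₀) ≤
          hopEnergy α β d M ξ ((retrieve α β d M ξ)^[t] x₀) := by
    intro t
    rw [Function.iterate_succ_apply']
    exact energy_step α β hα hβ d M hM ξ _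
  refine ⟨hstep, _, tendsto_atTop_ciInf (antitone_nat_of_succ_le hstep) ?_⟩
  refine hb.mono ?_
  rintro _ ⟨t, rfl⟩
  exact ⟨_, rfl⟩
end
end

section
/- (One-step retrieval error bound, Theorem 3, dense case α = 1.) Let ξ_1, …, ξ_M ∈ ℝ^d (M ≥ 2) be memory patterns with matrix Ξ, let β > 0, let m = max_ν ‖ξ_ν‖₂, fix an index μ and a query x ∈ ℝ^d, and set Δ_μ(x) = ⟨ξ_μ, x⟩ − max_{ν ≠ μ} ⟨ξ_ν, x⟩. If Δ_μ(x) ≥ 0, then the dense retrieval update T_dense(x) = Ξ · softmax(β Ξᵀ x) satisfies ‖T_dense(x) − ξ_μ‖₂ ≤ 2 m (M − 1) exp(−β Δ_μ(x)). -/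
open Finset Real RealInnerProductSpace

noncomputable section

/-- The softmax distribution `softmax(z)_ν = exp(z_ν) / Σ_κ exp(z_κ)`. -/
noncomputable def softmax (M : ℕ) (z : Fin M → ℝ) : Fin M → ℝ :=
  fun ν => Real.exp (z ν) / ∑ κ, Real.exp (z κ)

/-- one-step retrieval error bound, Theorem 3, dense case `α = 1`:
if `Δ_μ(x) = ⟨ξ_μ, x⟩ − max_{ν ≠ μ} ⟨ξ_ν, x⟩ ≥ 0` then the dense update
`T_dense(x) = Ξ · softmax(β Ξᵀ x)` satisfies
`‖T_dense(x) − ξ_μ‖₂ ≤ 2 m (M − 1) exp(−β Δ_μ(x))`. -/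
theorem stmt12 (d M : ℕ) (hM : 2 ≤ M) (ξ : Fin M → EuclideanSpace ℝ (Fin d))
    (β : ℝ) (hβ : 0 < β) (m : ℝ)
    (hm : m = Finset.univ.sup' (Finset.univ_nonempty_iff.mpr ⟨⟨0, by omega⟩⟩)
      (fun ν => ‖ξ ν‖))
    (μ : Fin M) (x : EuclideanSpace ℝ (Fin d))
    (hne : (Finset.univ.erase μ).Nonempty) (Δ : ℝ)
    (hΔ : Δ = ⟪ξ μ, x⟫ - (Finset.univ.erase μ).sup' hne (fun ν => ⟪ξ ν, x⟫))
    (hΔ0 : 0 ≤ Δ) :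
    ‖(∑ ν, softmax M (fun κ => β * ⟪ξ κ, x⟫) ν • ξ ν) - ξ μ‖ ≤
      2 * m * ((M : ℝ) - 1) * Real.exp (-β * Δ) := by
  have hm' : ∀ ν, ‖ξ ν‖ ≤ m := by
    intro ν
    rw [hm]
    exact Finset.le_sup' (fun ν => ‖ξ ν‖) (Finset.mem_univ ν)
  have hm0 : 0 ≤ m := (norm_nonneg _).trans (hm' μ)
  have hgap : ∀ ν ∈ Finset.univ.erase μ, ⟪ξ ν, x⟫ ≤ ⟪ξ μ, x⟫ - Δ := by
    intro ν hν
    have := Finset.le_sup' (fun ν => ⟪ξ ν, x⟫) hν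
    linarith
  set z : Fin M → ℝ := fun κ => β * ⟪ξ κ, x⟫ with hz
  have hS : 0 < ∑ κ, Real.exp (z κ) :=
    Finset.sum_pos (fun _ _ => Real.exp_pos _) ⟨μ, Finset.mem_univ μ⟩
  have hp0 : ∀ ν, 0 ≤ softmax M z ν := fun ν => div_nonneg (Real.exp_pos _).le hS.le
  have hp1 : ∑ ν, softmax M z ν = 1 := by
    simp only [softmax]
    rw [← Finset.sum_div, div_self hS.ne']
  have hple : ∀ ν ∈ Finset.univ.erase μ, softmax M z ν ≤ Real.exp (-β * Δ) := by
    intro ν hν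
    simp only [softmax]
    rw [div_le_iff₀ hS]
    have h1 : Real.exp (z μ) ≤ ∑ κ, Real.exp (z κ) :=
      Finset.single_le_sum (f := fun κ => Real.exp (z κ))
        (fun _ _ => (Real.exp_pos _).le) (Finset.mem_univ μ)
    have h2 : Real.exp (z ν) ≤ Real.exp (-β * Δ) * Real.exp (z μ) := by
      rw [← Real.exp_add]
      apply Real.exp_le_exp.mpr
      have := mul_le_mul_of_nonneg_left (hgap ν hν) hβ.le
      simp only [hz]
      linarith
    exact h2.trans (mul_le_mul_of_nonneg_left h1 (Real.exp_pos _).le)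
  have heq : (∑ ν, softmax M z ν • ξ ν) - ξ μ
      = ∑ ν ∈ Finset.univ.erase μ, softmax M z ν • (ξ ν - ξ μ) := by
    rw [Finset.sum_erase _ (by simp)]
    simp only [smul_sub]
    rw [Finset.sum_sub_distrib, ← Finset.sum_smul, hp1, one_smul]
  rw [heq]
  have hb : ∀ ν ∈ Finset.univ.erase μ,
      ‖softmax M z ν • (ξ ν - ξ μ)‖ ≤ Real.exp (-β * Δ) * (2 * m) := by
    intro ν hν
    rw [norm_smul, Real.norm_of_nonneg (hp0 ν)]
    have h3 : ‖ξ ν - ξ μ‖ ≤ 2 * m := by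
      have := norm_sub_le (ξ ν) (ξ μ)
      linarith [hm' ν, hm' μ]
    exact mul_le_mul (hple ν hν) h3 (norm_nonneg _) (Real.exp_pos _).le
  refine (norm_sum_le_of_le _ hb).trans (le_of_eq ?_)
  rw [Finset.sum_const, Finset.card_erase_of_mem (Finset.mem_univ μ), Finset.card_univ,
    Fintype.card_fin, nsmul_eq_mul, Nat.cast_sub (by omega)]
  push_cast
  ring
end
end

section
/- (Exact one-step sparse retrieval, supporting Theorem B.1.) Fix α = 2, β > 0, memory patterns ξ_1, …, ξ_M ∈ ℝ^d with matrix Ξ, an index μ, and a query x ∈ ℝ^d. If β (⟨ξ_μ, x⟩ − ⟨ξ_ν, x⟩) ≥ 1 for every ν ≠ μ, then 2-EntMax(β Ξᵀ x) equals the vertex e_μ of the simplex (the μ-th standard basis vector), and hence the sparse retrieval map satisfies T(x) = Ξ · 2-EntMax(β Ξᵀ x) = ξ_μ, i.e. the retrieval error ‖T(x) − ξ_μ‖₂ is exactly 0. -/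
open Finset Real RealInnerProductSpace

noncomputable section

theorem obj_two (M : ℕ) (z q : Fin M → ℝ) (hq : ∑ ν, q ν = 1) :
    (∑ ν, q ν * z ν) - Psi 2 M q = (∑ ν, q ν * z ν) - (1 / 2) * ∑ ν, q ν ^ 2 + 1 / 2 := by
  have h2 : ∀ ν, q ν ^ (2 : ℝ) = q ν ^ 2 := fun ν => Real.rpow_two _
  unfold Psi
  rw [if_neg (by norm_num)]
  simp only [h2, Finset.sum_sub_distrib, hq]
  ring

theorem single_mem_simplex (M : ℕ) (μ : Fin M) : (Pi.single μ 1 : Fin M → ℝ) ∈ simplex M := by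
  refine ⟨fun ν => ?_, by simp⟩
  by_cases hν : ν = μ
  · subst hν; simp
  · simp [hν]

theorem obj_gap (M : ℕ) (z : Fin M → ℝ) (μ : Fin M) (hz : ∀ ν, ν ≠ μ → 1 ≤ z μ - z ν)
    (q : Fin M → ℝ) (hq : q ∈ simplex M) :
    (∑ ν, q ν * z ν) - Psi 2 M q + (1 / 2) * ∑ ν, (q ν - (Pi.single μ 1 : Fin M → ℝ) ν) ^ 2 ≤
      (∑ ν, (Pi.single μ 1 : Fin M → ℝ) ν * z ν) - Psi 2 M (Pi.single μ 1) := by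
  rw [obj_two M z q hq.2, obj_two M z _ (single_mem_simplex M μ).2]
  set e : Fin M → ℝ := Pi.single μ 1 with he
  have he2 : ∀ ν, e ν ^ 2 = e ν := by
    intro ν
    by_cases hν : ν = μ
    · subst hν; simp [he]
    · simp [he, hν]
  have hez : ∑ ν, e ν * z ν = z μ := by simp [he, Pi.single_apply]
  have hqe : ∑ ν, q ν * e ν = q μ := by simp [he, Pi.single_apply]
  have hes : ∑ ν, e ν = 1 := by simp [he]
  have h1 : ∑ ν, (q ν - e ν) ^ 2 = ∑ ν, q ν ^ 2 - 2 * q μ + 1 := by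
    rw [← hqe, ← hes, Finset.mul_sum, ← Finset.sum_sub_distrib, ← Finset.sum_add_distrib]
    refine Finset.sum_congr rfl fun ν _ => ?_
    have := he2 ν
    linear_combination this
  have h2 : ∑ ν, q ν * z ν ≤ z μ - 1 + q μ := by
    calc ∑ ν, q ν * z ν ≤ ∑ ν, (q ν * (z μ - 1) + q ν * e ν) := by
          refine Finset.sum_le_sum fun ν _ => ?_
          by_cases hν : ν = μ
          · subst hν; simp [he]; linarith
          · have := hz ν hν
            simp only [he, Pi.single_eq_of_ne hν]
            nlinarith [hq.1 ν]
      _ = z μ - 1 + q μ := by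
          rw [Finset.sum_add_distrib, ← Finset.sum_mul, hq.2, hqe]; ring
  simp only [he2]
  rw [hez, h1, hes]
  linarith

theorem entMax_two_eq (M : ℕ) (z : Fin M → ℝ) (μ : Fin M) (hz : ∀ ν, ν ≠ μ → 1 ≤ z μ - z ν) :
    entMax 2 M z = Pi.single μ 1 := by
  have hex : ∃ p ∈ simplex M, ∀ q ∈ simplex M,
      (∑ μ, q μ * z μ) - Psi 2 M q ≤ (∑ μ, p μ * z μ) - Psi 2 M p := by
    refine ⟨_, single_mem_simplex M μ, fun q hq => ?_⟩
    have h1 := obj_gap M z μ hz q hq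
    have h2 : 0 ≤ ∑ ν, (q ν - (Pi.single μ 1 : Fin M → ℝ) ν) ^ 2 :=
      Finset.sum_nonneg fun ν _ => sq_nonneg _
    linarith
  unfold entMax
  rw [dif_pos hex]
  obtain ⟨hp, hmax⟩ := hex.choose_spec
  generalize hex.choose = p at hp hmax
  have h1 := obj_gap M z μ hz p hp
  have h2 := hmax _ (single_mem_simplex M μ)
  funext ν
  have h3 : (p ν - (Pi.single μ 1 : Fin M → ℝ) ν) ^ 2 ≤
      ∑ ν, (p ν - (Pi.single μ 1 : Fin M → ℝ) ν) ^ 2 :=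
    Finset.single_le_sum (f := fun ν => (p ν - (Pi.single μ 1 : Fin M → ℝ) ν) ^ 2)
      (fun ν _ => sq_nonneg _) (Finset.mem_univ ν)
  have h4 : (p ν - (Pi.single μ 1 : Fin M → ℝ) ν) ^ 2 = 0 :=
    le_antisymm (by linarith) (sq_nonneg _)
  exact sub_eq_zero.mp (pow_eq_zero_iff (by norm_num) |>.mp h4)

/-- exact one-step sparse retrieval, supporting Theorem B.1: for
`α = 2`, if `β (⟨ξ_μ, x⟩ − ⟨ξ_ν, x⟩) ≥ 1` for every `ν ≠ μ`, then
`2-EntMax(β Ξᵀ x)` is the vertex `e_μ` of the simplex, the retrieval map returns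
exactly `ξ_μ`, and the retrieval error is exactly `0`. -/
theorem stmt15 (d M : ℕ) (hM : 1 ≤ M) (ξ : Fin M → EuclideanSpace ℝ (Fin d))
    (β : ℝ) (hβ : 0 < β) (μ : Fin M) (x : EuclideanSpace ℝ (Fin d))
    (h : ∀ ν, ν ≠ μ → 1 ≤ β * (⟪ξ μ, x⟫ - ⟪ξ ν, x⟫)) :
    entMax 2 M (fun κ => β * ⟪ξ κ, x⟫) = Pi.single μ 1 ∧
    retrieve 2 β d M ξ x = ξ μ ∧
    ‖retrieve 2 β d M ξ x - ξ μ‖ = 0 := by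
  have h1 : entMax 2 M (fun κ => β * ⟪ξ κ, x⟫) = Pi.single μ 1 := by
    apply entMax_two_eq
    intro ν hν
    have := h ν hν
    rw [mul_sub] at this
    exact this
  have h2 : retrieve 2 β d M ξ x = ξ μ := by
    unfold retrieve
    rw [h1]
    simp [Pi.single_apply]
  exact ⟨h1, h2, by rw [h2, sub_self, norm_zero]⟩
end
end
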